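/- Let l ∈ ℕ and w_l(x) = ∂_s[G_−(x,s) − G_+(x,s)]|_{s=l/2} for x > 0. Then x^{l/2}·w_l(x) → 2·(−1)^l·(l−1)! as x → 0⁺; that is, the leading coefficient of w_l at x = 0 is ∂_s b_0^−(s)|_{s=l/2} = 2·(−1)^l·(l−1)!. -/

import Mathlib

/-- `b_j^+(s) = (j! Γ(2s+j+1))⁻¹`, with the reciprocal Gamma convention
(Mathlib's `Complex.Gamma` vanishes at its poles). -/
noncomputable def bcoef (s : ℂ) (j : ℕ) : ℂ :=
  ((j.factorial : ℂ) * Complex.Gamma (2 * s + (j : ℂ) + 1))⁻¹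

/-- `G_+(x,s) = Σ_{j=0}^∞ b_j^+(s) x^{s+j}` for `x > 0`. -/
noncomputable def Gp (x : ℝ) (s : ℂ) : ℂ :=
  ∑' j : ℕ, bcoef s j * (x : ℂ) ^ (s + (j : ℂ))

/-- `G_-(x,s) = G_+(x,-s)` for `x > 0`. -/
noncomputable def Gm (x : ℝ) (s : ℂ) : ℂ := Gp x (-s)

/-- `w_l(x) = ∂_s[G_−(x,s) − G_+(x,s)]|_{s=l/2}`. -/
noncomputable def wl (l : ℕ) (x : ℝ) : ℂ :=
  deriv (fun s : ℂ => Gm x s - Gp x s) ((l : ℂ) / 2)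

open Filter Topology Metric

/-- The exponential generating series of a sequence of complex numbers, on the real line. -/
noncomputable def expSeries (c : ℕ → ℂ) (x : ℝ) : ℂ :=
  ∑' j : ℕ, c j * ((x : ℂ) ^ j / (j.factorial : ℂ))

/-- The reciprocal Gamma factor of `bcoef`. -/
noncomputable def invGammaShift (j : ℕ) (s : ℂ) : ℂ :=
  (Complex.Gamma (2 * s + (j : ℂ) + 1))⁻¹

lemma norm_mul_pow_div_factorial_le {a : ℂ} {C : ℝ} (ha : ‖a‖ ≤ C) (x : ℝ) (j : ℕ) :
    ‖a * ((x : ℂ) ^ j / (j.factorial : ℂ))‖ ≤ C * (|x| ^ j / j.factorial) := by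
  rw [norm_mul, norm_div, norm_pow, Complex.norm_real, Complex.norm_natCast, Real.norm_eq_abs]
  gcongr

lemma summable_mul_pow_div_factorial {c : ℕ → ℂ} {C : ℝ} (hc : ∀ j, ‖c j‖ ≤ C) (x : ℝ) :
    Summable fun j : ℕ => c j * ((x : ℂ) ^ j / (j.factorial : ℂ)) :=
  .of_norm_bounded ((Real.summable_pow_div_factorial |x|).mul_left C)
    fun j => norm_mul_pow_div_factorial_le (hc j) x j

lemma tendsto_expSeries_zero {c : ℕ → ℂ} {C : ℝ} (hc : ∀ j, ‖c j‖ ≤ C) :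
    Tendsto (expSeries c) (𝓝 0) (𝓝 (c 0)) := by
  have hsum : ∑' j : ℕ, c j * (((0 : ℝ) : ℂ) ^ j / (j.factorial : ℂ)) = c 0 := by
    rw [tsum_eq_single 0 fun j hj => by simp [hj]]
    simp
  rw [← hsum]
  refine tendsto_tsum_of_dominated_convergence
    ((Real.summable_pow_div_factorial 1).mul_left C) (fun j => ?_) ?_
  · exact Continuous.tendsto (by fun_prop) 0
  · filter_upwards [closedBall_mem_nhds (0 : ℝ) one_pos] with x hx j
    have hC : 0 ≤ C := (norm_nonneg _).trans (hc 0)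
    have hx1 : |x| ≤ 1 := by simpa using hx
    refine (norm_mul_pow_div_factorial_le (hc j) x j).trans ?_
    gcongr

lemma expSeries_eq_mul_of_zero {c : ℕ → ℂ} {C : ℝ} (hc : ∀ j, ‖c j‖ ≤ C) (h0 : c 0 = 0) (x : ℝ) :
    expSeries c x = x * expSeries (fun j => c (j + 1) / ((j : ℂ) + 1)) x := by
  rw [expSeries, (summable_mul_pow_div_factorial hc x).tsum_eq_zero_add, h0, zero_mul, zero_add,
    expSeries, ← tsum_mul_left]
  refine tsum_congr fun j => ?_
  have h1 : ((j : ℂ) + 1) ≠ 0 := by exact_mod_cast j.succ_ne_zero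
  have h2 : (j.factorial : ℂ) ≠ 0 := by exact_mod_cast j.factorial_ne_zero
  rw [Nat.factorial_succ]
  push_cast
  field_simp
  ring

lemma tendsto_ofReal_log_mul_self :
    Tendsto (fun x : ℝ => ((Real.log x : ℝ) : ℂ) * (x : ℂ)) (𝓝[>] 0) (𝓝 0) := by
  have h := tendsto_log_mul_rpow_nhdsGT_zero one_pos
  simp only [Real.rpow_one] at h
  simpa [Function.comp_def] using (Complex.continuous_ofReal.tendsto 0).comp h

lemma tendsto_log_mul_expSeries {c : ℕ → ℂ} {C : ℝ} (hc : ∀ j, ‖c j‖ ≤ C) (h0 : c 0 = 0) :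
    Tendsto (fun x : ℝ => ((Real.log x : ℝ) : ℂ) * expSeries c x) (𝓝[>] 0) (𝓝 0) := by
  have hd (j : ℕ) : ‖c (j + 1) / ((j : ℂ) + 1)‖ ≤ C := by
    rw [norm_div]
    refine (div_le_self (norm_nonneg _) ?_).trans (hc _)
    rw [← Nat.cast_succ, Complex.norm_natCast]
    exact_mod_cast Nat.succ_pos j
  have h := tendsto_ofReal_log_mul_self.mul
    ((tendsto_expSeries_zero hd).mono_left nhdsWithin_le_nhds)
  rw [zero_mul] at h
  refine h.congr fun x => ?_
  rw [expSeries_eq_mul_of_zero hc h0, mul_assoc]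

lemma differentiable_invGammaShift (j : ℕ) : Differentiable ℂ (invGammaShift j) :=
  Complex.differentiable_one_div_Gamma.comp
    (f := fun s : ℂ => 2 * s + (j : ℂ) + 1) (by fun_prop)

lemma invGammaShift_eq_mul_succ (j : ℕ) (s : ℂ) :
    invGammaShift j s = (2 * s + (j : ℂ) + 1) * invGammaShift (j + 1) s := by
  rw [invGammaShift, Complex.one_div_Gamma_eq_self_mul_one_div_Gamma_add_one, invGammaShift]
  push_cast
  ring_nf

lemma norm_invGammaShift_succ_le {j : ℕ} {s : ℂ} (h : 0 ≤ 2 * s.re + j) :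
    ‖invGammaShift (j + 1) s‖ ≤ ‖invGammaShift j s‖ := by
  rw [invGammaShift_eq_mul_succ j s, norm_mul]
  refine le_mul_of_one_le_left (norm_nonneg _) ?_
  refine le_trans ?_ (Complex.re_le_norm _)
  simpa using h

lemma exists_norm_invGammaShift_le {K : Set ℂ} (hK : IsCompact K) :
    ∃ C : ℝ, ∀ j, ∀ s ∈ K, ‖invGammaShift j s‖ ≤ C := by
  choose B hB using fun j : ℕ =>
    hK.exists_bound_of_continuousOn (differentiable_invGammaShift j).continuous.continuousOn
  obtain ⟨M, hM⟩ := hK.exists_bound_of_continuousOn (f := fun s : ℂ => s) continuousOn_id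
  obtain ⟨N, hN⟩ := exists_nat_ge (2 * M)
  have small {j : ℕ} (hj : j ≤ N) {s : ℂ} (hs : s ∈ K) :
      ‖invGammaShift j s‖ ≤ ∑ i ∈ Finset.range (N + 1), |B i| :=
    ((hB j s hs).trans (le_abs_self _)).trans
      (Finset.single_le_sum (f := fun i => |B i|) (fun i _ => abs_nonneg _)
        (Finset.mem_range.2 (Nat.lt_succ_of_le hj)))
  refine ⟨∑ i ∈ Finset.range (N + 1), |B i|, fun j s hs => ?_⟩
  rcases le_total j N with hj | hj
  · exact small hj hs
  · induction j, hj using Nat.le_induction with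
    | base => exact small le_rfl hs
    | succ j hj ih =>
      refine (norm_invGammaShift_succ_le ?_).trans ih
      have h1 := (abs_le.1 ((Complex.abs_re_le_norm s).trans (hM s hs))).1
      have h2 : (N : ℝ) ≤ j := by exact_mod_cast hj
      linarith

lemma exists_norm_deriv_invGammaShift_le (s : ℂ) :
    ∃ C : ℝ, ∀ j, ‖deriv (invGammaShift j) s‖ ≤ C := by
  obtain ⟨C, hC⟩ := exists_norm_invGammaShift_le (isCompact_closedBall s 1)
  exact ⟨C / 1, fun j => Complex.norm_deriv_le_of_forall_mem_sphere_norm_le one_pos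
    (differentiable_invGammaShift j).diffContOnCl fun z hz => hC j z (sphere_subset_closedBall hz)⟩

lemma hasDerivAt_expSeries_invGammaShift (x : ℝ) (s : ℂ) :
    HasDerivAt (fun z => expSeries (fun j => invGammaShift j z) x)
      (expSeries (fun j => deriv (invGammaShift j) s) x) s := by
  obtain ⟨C, hC⟩ := exists_norm_invGammaShift_le (isCompact_closedBall s 1)
  have hu := (Real.summable_pow_div_factorial |x|).mul_left C
  have hd (j : ℕ) : DifferentiableOn ℂ
      (fun z => invGammaShift j z * ((x : ℂ) ^ j / (j.factorial : ℂ))) (ball s 1) :=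
    ((differentiable_invGammaShift j).mul_const _).differentiableOn
  have hle (j : ℕ) (z : ℂ) (hz : z ∈ ball s 1) :=
    norm_mul_pow_div_factorial_le (hC j z (ball_subset_closedBall hz)) x j
  have hs : s ∈ ball s 1 := mem_ball_self one_pos
  have hsum := Complex.hasSum_deriv_of_summable_norm hu hd isOpen_ball hle hs
  have hdiff := (Complex.differentiableOn_tsum_of_summable_norm hu hd isOpen_ball
    hle).differentiableAt (isOpen_ball.mem_nhds hs)
  have heq : expSeries (fun j => deriv (invGammaShift j) s) x =
      deriv (fun z => expSeries (fun j => invGammaShift j z) x) s := by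
    unfold expSeries
    rw [← hsum.tsum_eq]
    exact tsum_congr fun j => (deriv_mul_const (differentiable_invGammaShift j s) _).symm
  rw [heq]
  exact hdiff.hasDerivAt

lemma Gp_eq_cpow_mul_expSeries {x : ℝ} (hx : 0 < x) (s : ℂ) :
    Gp x s = (x : ℂ) ^ s * expSeries (fun j => invGammaShift j s) x := by
  have hx' : (x : ℂ) ≠ 0 := by exact_mod_cast hx.ne'
  rw [Gp, expSeries, ← tsum_mul_left]
  refine tsum_congr fun j => ?_
  rw [bcoef, invGammaShift, Complex.cpow_add _ _ hx', Complex.cpow_natCast, mul_inv]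
  ring

lemma hasDerivAt_Gp {x : ℝ} (hx : 0 < x) (s : ℂ) :
    HasDerivAt (Gp x)
      ((x : ℂ) ^ s * (((Real.log x : ℝ) : ℂ) * expSeries (fun j => invGammaShift j s) x +
        expSeries (fun j => deriv (invGammaShift j) s) x)) s := by
  have hx' : (x : ℂ) ≠ 0 := by exact_mod_cast hx.ne'
  have h := ((hasDerivAt_id s).const_cpow (c := (x : ℂ)) (Or.inl hx')).mul
    (hasDerivAt_expSeries_invGammaShift x s)
  rw [show Gp x = _ from funext fun z => Gp_eq_cpow_mul_expSeries hx z]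
  refine h.congr_deriv ?_
  simp only [id, mul_one, ← Complex.ofReal_log hx.le]
  ring

lemma cpow_mul_wl {x : ℝ} (hx : 0 < x) (l : ℕ) :
    (x : ℂ) ^ ((l : ℂ) / 2) * wl l x =
      -(((Real.log x : ℝ) : ℂ) * expSeries (fun j => invGammaShift j (-((l : ℂ) / 2))) x +
          expSeries (fun j => deriv (invGammaShift j) (-((l : ℂ) / 2))) x) -
        (x : ℂ) ^ l * (((Real.log x : ℝ) : ℂ) *
            expSeries (fun j => invGammaShift j ((l : ℂ) / 2)) x +
          expSeries (fun j => deriv (invGammaShift j) ((l : ℂ) / 2)) x) := by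
  have hx' : (x : ℂ) ≠ 0 := by exact_mod_cast hx.ne'
  have hm : HasDerivAt (Gm x) _ ((l : ℂ) / 2) :=
    (hasDerivAt_Gp hx (-((l : ℂ) / 2))).comp_of_eq _ (hasDerivAt_neg _) rfl
  rw [wl, (hm.fun_sub (hasDerivAt_Gp hx ((l : ℂ) / 2))).deriv]
  have h1 : (x : ℂ) ^ ((l : ℂ) / 2) * (x : ℂ) ^ (-((l : ℂ) / 2)) = 1 := by
    rw [← Complex.cpow_add _ _ hx', add_neg_cancel, Complex.cpow_zero]
  have h2 : (x : ℂ) ^ ((l : ℂ) / 2) * (x : ℂ) ^ ((l : ℂ) / 2) = (x : ℂ) ^ l := by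
    rw [← Complex.cpow_add _ _ hx', add_halves, Complex.cpow_natCast]
  rw [← h2]
  linear_combination (-(((Real.log x : ℝ) : ℂ) *
    expSeries (fun j => invGammaShift j (-((l : ℂ) / 2))) x +
      expSeries (fun j => deriv (invGammaShift j) (-((l : ℂ) / 2))) x)) * h1

lemma deriv_inv_Gamma_neg_nat (n : ℕ) :
    deriv (fun z : ℂ => (Complex.Gamma z)⁻¹) (-(n : ℂ)) = (-1) ^ n * (n.factorial : ℂ) := by
  have hdiff := Complex.differentiable_one_div_Gamma
  have hrec (z : ℂ) : deriv (fun z : ℂ => (Complex.Gamma z)⁻¹) z =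
      (Complex.Gamma (z + 1))⁻¹ + z * deriv (fun z : ℂ => (Complex.Gamma z)⁻¹) (z + 1) := by
    have h := (hasDerivAt_id z).mul ((hdiff (z + 1)).hasDerivAt.comp_add_const z 1)
    have h' : HasDerivAt (fun z : ℂ => (Complex.Gamma z)⁻¹) _ z :=
      h.congr_of_eventuallyEq (Eventually.of_forall
        Complex.one_div_Gamma_eq_self_mul_one_div_Gamma_add_one)
    rw [h'.deriv]
    simp
  induction n with
  | zero => rw [hrec]; simp
  | succ n ih =>
    rw [hrec, show -((n + 1 : ℕ) : ℂ) + 1 = -(n : ℂ) by push_cast; ring, ih,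
      Complex.Gamma_neg_nat_eq_zero, Nat.factorial_succ]
    push_cast
    ring

lemma invGammaShift_zero_neg_half {l : ℕ} (hl : 0 < l) :
    invGammaShift 0 (-((l : ℂ) / 2)) = 0 := by
  obtain ⟨n, rfl⟩ := Nat.exists_eq_add_of_lt hl
  rw [invGammaShift, show 2 * -(((0 + n + 1 : ℕ) : ℂ) / 2) + ((0 : ℕ) : ℂ) + 1 = -(n : ℂ) by
    push_cast; ring, Complex.Gamma_neg_nat_eq_zero, inv_zero]

lemma deriv_invGammaShift_zero_neg_half {l : ℕ} (hl : 0 < l) :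
    deriv (invGammaShift 0) (-((l : ℂ) / 2)) =
      -(2 * (-1 : ℂ) ^ l * ((l - 1).factorial : ℂ)) := by
  obtain ⟨n, rfl⟩ : ∃ n, l = n + 1 := ⟨l - 1, by omega⟩
  set s : ℂ := -(((n + 1 : ℕ) : ℂ) / 2) with hs
  have hpt : 2 * s + ((0 : ℕ) : ℂ) + 1 = -(n : ℂ) := by rw [hs]; push_cast; ring
  have hlin : HasDerivAt (fun z : ℂ => 2 * z + ((0 : ℕ) : ℂ) + 1) 2 s := by
    simpa using (((hasDerivAt_id s).const_mul 2).add_const ((0 : ℕ) : ℂ)).add_const 1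
  have h : HasDerivAt (invGammaShift 0) _ s :=
    (Complex.differentiable_one_div_Gamma (-(n : ℂ))).hasDerivAt.comp_of_eq s hlin hpt.symm
  rw [h.deriv, deriv_inv_Gamma_neg_nat, Nat.add_sub_cancel]
  ring

/-- the leading coefficient of `w_l` at `x = 0` is
`∂_s b_0^−(s)|_{s=l/2} = 2·(−1)^l·(l−1)!`, i.e. `x^{l/2}·w_l(x) → 2·(−1)^l·(l−1)!`
as `x → 0⁺`. -/
theorem wl_leading_coefficient (l : ℕ) (hl : 0 < l) :
    Filter.Tendsto (fun x : ℝ => (x : ℂ) ^ ((l : ℂ) / 2) * wl l x)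
      (nhdsWithin 0 (Set.Ioi 0))
      (nhds (2 * (-1 : ℂ) ^ l * ((l - 1).factorial : ℂ))) := by
  obtain ⟨C₁, hC₁⟩ := exists_norm_invGammaShift_le (isCompact_singleton (x := -((l : ℂ) / 2)))
  obtain ⟨C₂, hC₂⟩ := exists_norm_deriv_invGammaShift_le (-((l : ℂ) / 2))
  obtain ⟨C₃, hC₃⟩ := exists_norm_invGammaShift_le (isCompact_singleton (x := (l : ℂ) / 2))
  obtain ⟨C₄, hC₄⟩ := exists_norm_deriv_invGammaShift_le ((l : ℂ) / 2)
  have t₁ := tendsto_log_mul_expSeries (fun j => hC₁ j _ rfl) (invGammaShift_zero_neg_half hl)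
  have t₂ := (tendsto_expSeries_zero hC₂).mono_left (nhdsWithin_le_nhds (s := Set.Ioi 0))
  have t₃ := (tendsto_expSeries_zero (fun j => hC₃ j _ rfl)).mono_left
    (nhdsWithin_le_nhds (s := Set.Ioi 0))
  have t₄ := (tendsto_expSeries_zero hC₄).mono_left (nhdsWithin_le_nhds (s := Set.Ioi 0))
  have hpow (k : ℕ) : Tendsto (fun x : ℝ => (x : ℂ) ^ k) (𝓝[>] 0) (𝓝 (0 ^ k)) := by
    have h : Continuous fun x : ℝ => (x : ℂ) ^ k := by fun_prop
    simpa using (h.tendsto 0).mono_left (nhdsWithin_le_nhds (s := Set.Ioi 0))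
  have t := (t₁.add t₂).neg.sub (((hpow (l - 1)).mul (tendsto_ofReal_log_mul_self.mul t₃)).add
    ((hpow l).mul t₄))
  rw [deriv_invGammaShift_zero_neg_half hl, zero_pow hl.ne'] at t
  simp only [zero_mul, mul_zero, add_zero, zero_add, sub_zero, neg_neg] at t
  refine t.congr' ?_
  filter_upwards [self_mem_nhdsWithin] with x hx
  rw [cpow_mul_wl hx, ← pow_sub_one_mul hl.ne' (x : ℂ)]
  ring
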